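/- arXiv:2205.09008 — 2 statements merged into one kernel-verified Lean document; each statement's English description precedes it below -/
import Mathlib

section
/- The pair (Q*, F*) is a saddle point of the two-bidder reduced zero-sum game: for every compatible CDF F, Rev_F(Q*) ≥ Rev_{F*}(Q*); for every Borel probability measure Q on [0, B], Rev_{F*}(Q) ≤ Rev_{F*}(Q*); and Rev_{F*}(Q*) = 2L − L²/B. -/
open MeasureTheory

lemma H_eq {L r : ℝ} (hL : 0 < L) (hr : L < r) :
    r * dslope Real.log L r = r / (r - L) * Real.log (r / L) := by
  rw [dslope_of_ne _ hr.ne', slope_def_field, Real.log_div (by linarith) hL.ne']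
  ring

lemma H_L {L : ℝ} (hL : 0 < L) : L * dslope Real.log L L = 1 := by
  rw [dslope_same, Real.deriv_log]
  field_simp

lemma D_cont {L B : ℝ} (hL : 0 < L) : ContinuousOn (dslope Real.log L) (Set.Icc L B) := by
  intro x hx
  have hx0 : x ≠ 0 := by linarith [hx.1]
  apply ContinuousAt.continuousWithinAt
  by_cases h : x = L
  · subst h
    exact continuousAt_dslope_same.2 (Real.differentiableAt_log hx0)
  · exact (continuousAt_dslope_of_ne h).2 (Real.continuousAt_log hx0)

lemma D_deriv {L r : ℝ} (hL : 0 < L) (hr : L < r) :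
    HasDerivAt (dslope Real.log L) (1 / (r * (r - L)) - (Real.log r - Real.log L) / (r - L) ^ 2) r := by
  have h1 : HasDerivAt (fun x => (Real.log x - Real.log L) / (x - L))
      ((r⁻¹ * (r - L) - (Real.log r - Real.log L) * 1) / (r - L) ^ 2) r := by
    apply HasDerivAt.div
    · exact (Real.hasDerivAt_log (by linarith)).sub_const _
    · exact (hasDerivAt_id r).sub_const _
    · linarith
  have h2 : dslope Real.log L =ᶠ[nhds r] (fun x => (Real.log x - Real.log L) / (x - L)) := by
    filter_upwards [lt_mem_nhds hr] with x hx
    rw [dslope_of_ne _ hx.ne', slope_def_field]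
  refine (h1.congr_of_eventuallyEq h2).congr_deriv ?_
  have : r - L ≠ 0 := by linarith
  have : r ≠ 0 := by linarith
  field_simp

noncomputable def hq (L r : ℝ) : ℝ := 1 / (r - L) - L * (Real.log r - Real.log L) / (r - L) ^ 2

lemma H_deriv {L r : ℝ} (hL : 0 < L) (hr : L < r) :
    HasDerivAt (fun x => x * dslope Real.log L x) (hq L r) r := by
  refine ((hasDerivAt_id r).mul (D_deriv hL hr)).congr_deriv ?_
  rw [dslope_of_ne _ hr.ne', slope_def_field]
  have : r - L ≠ 0 := by linarith
  have : r ≠ 0 := by linarith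
  unfold hq
  simp only [id]
  field_simp
  ring

lemma log_bd {L r : ℝ} (hL : 0 < L) (hr : L < r) :
    L * (Real.log r - Real.log L) ≤ r - L ∧ r - L ≤ r * (Real.log r - Real.log L) := by
  have hr0 : 0 < r := by linarith
  constructor
  · rw [← Real.log_div hr0.ne' hL.ne']
    have := Real.log_le_sub_one_of_pos (div_pos hr0 hL)
    calc L * Real.log (r / L) ≤ L * (r / L - 1) := by gcongr
      _ = r - L := by field_simp
  · have := Real.log_le_sub_one_of_pos (div_pos hL hr0)
    rw [Real.log_div hL.ne' hr0.ne'] at this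
    have h2 : r * (Real.log L - Real.log r) ≤ r * (L / r - 1) := by gcongr
    have h3 : r * (L / r - 1) = L - r := by field_simp
    linarith

lemma hq_nonneg {L r : ℝ} (hL : 0 < L) (hr : L < r) : 0 ≤ hq L r := by
  have h := (log_bd hL hr).1
  have h1 : 0 < r - L := by linarith
  have : hq L r = ((r - L) - L * (Real.log r - Real.log L)) / (r - L) ^ 2 := by
    unfold hq; field_simp
  rw [this]
  apply div_nonneg <;> nlinarith

/-- The convexity coefficient is nonnegative. -/
lemma A_nonneg {L r : ℝ} (hL : 0 < L) (hr : L < r) :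
    0 ≤ r * dslope Real.log L r - r * hq L r := by
  have h := (log_bd hL hr).2
  have h1 : 0 < r - L := by linarith
  have : r * dslope Real.log L r - r * hq L r
      = r * (r * (Real.log r - Real.log L) - (r - L)) / (r - L) ^ 2 := by
    rw [dslope_of_ne _ hr.ne', slope_def_field]
    unfold hq; field_simp; ring
  rw [this]
  apply div_nonneg
  · apply mul_nonneg <;> linarith
  · positivity

/-- First-order condition. -/
lemma foc {L r : ℝ} (hL : 0 < L) (hr : L < r) :
    r * hq L r + (r * dslope Real.log L r - r * hq L r) * (L / r) = 1 := by
  have h1 : r - L ≠ 0 := by linarith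
  have : r ≠ 0 := by linarith
  rw [dslope_of_ne _ hr.ne', slope_def_field]
  unfold hq; field_simp; ring

lemma hq_int {L b : ℝ} (hL : 0 < L) (hb : L ≤ b) :
    IntegrableOn (hq L) (Set.Ioc L b) ∧ ∫ r in L..b, hq L r = b * dslope Real.log L b - 1 := by
  have hc : ContinuousOn (fun x => x * dslope Real.log L x) (Set.Icc L b) :=
    continuousOn_id.mul (D_cont hL)
  have hi : IntegrableOn (hq L) (Set.Ioc L b) :=
    intervalIntegral.integrableOn_deriv_of_nonneg hc (fun x hx => H_deriv hL hx.1)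
      (fun x hx => hq_nonneg hL hx.1)
  refine ⟨hi, ?_⟩
  rw [intervalIntegral.integral_eq_sub_of_hasDerivAt_of_le hb hc (fun x hx => H_deriv hL hx.1)
    ((intervalIntegrable_iff_integrableOn_Ioc_of_le hb).2 hi), H_L hL]

lemma A_int {L b : ℝ} (hL : 0 < L) (hb : L ≤ b) :
    IntegrableOn (fun r => (r * dslope Real.log L r - r * hq L r) / r ^ 2) (Set.Ioc L b) ∧
    ∫ r in L..b, (r * dslope Real.log L r - r * hq L r) / r ^ 2 = 1 / L - dslope Real.log L b := by
  have hc : ContinuousOn (fun x => - dslope Real.log L x) (Set.Icc L b) := (D_cont hL).neg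
  have hd : ∀ x ∈ Set.Ioo L b, HasDerivAt (fun x => - dslope Real.log L x)
      ((x * dslope Real.log L x - x * hq L x) / x ^ 2) x := by
    intro x hx
    refine ((D_deriv hL hx.1).neg).congr_deriv ?_
    rw [dslope_of_ne _ hx.1.ne', slope_def_field]
    have : x - L ≠ 0 := by linarith [hx.1]
    have : x ≠ 0 := by linarith [hx.1]
    unfold hq; field_simp; ring
  have hi := intervalIntegral.integrableOn_deriv_of_nonneg hc hd
      (fun x hx => div_nonneg (A_nonneg hL hx.1) (sq_nonneg x))
  refine ⟨hi, ?_⟩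
  rw [intervalIntegral.integral_eq_sub_of_hasDerivAt_of_le hb hc hd
    ((intervalIntegrable_iff_integrableOn_Ioc_of_le hb).2 hi), dslope_same, Real.deriv_log]
  ring

lemma hq_meas (L : ℝ) : Measurable (hq L) := by
  unfold hq; fun_prop

lemma Qm_eq {L B a : ℝ} (hL : 0 < L) (hLB : L < B) (ha : 0 < a)
    (haB : a * (B * dslope Real.log L B) = 1)
    (Qs : ℝ → ℝ) (h0 : ∀ r < 0, Qs r = 0) (h1 : ∀ r, 0 ≤ r → r ≤ L → Qs r = a)
    (h2 : ∀ r, L < r → r ≤ B → Qs r = a * (r * dslope Real.log L r))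
    (h3 : ∀ r, B < r → Qs r = 1)
    (Qm : Measure ℝ) [IsProbabilityMeasure Qm]
    (hQm : ∀ r, (Qm (Set.Iic r)).toReal = Qs r) :
    Qm = ENNReal.ofReal a • Measure.dirac 0 +
      (volume.restrict (Set.Ioc L B)).withDensity (fun r => ENNReal.ofReal (a * hq L r)) := by
  apply Measure.ext_of_Iic
  intro r
  have e : Qm (Set.Iic r) = ENNReal.ofReal (Qs r) := by
    rw [← hQm, ENNReal.ofReal_toReal (measure_ne_top _ _)]
  have key : ∀ b, L ≤ b → ∫⁻ x in Set.Ioc L b, ENNReal.ofReal (a * hq L x)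
      = ENNReal.ofReal (a * (b * dslope Real.log L b) - a) := by
    intro b hb
    obtain ⟨hi, he⟩ := hq_int hL hb
    rw [← ofReal_integral_eq_lintegral_ofReal (hi.const_mul a)]
    · rw [integral_const_mul, ← intervalIntegral.integral_of_le hb, he]; ring_nf
    · filter_upwards [ae_restrict_mem measurableSet_Ioc] with x hx
      exact mul_nonneg ha.le (hq_nonneg hL hx.1)
  have hmono : ∀ b, L ≤ b → a ≤ a * (b * dslope Real.log L b) := by
    intro b hb
    obtain ⟨hi, he⟩ := hq_int hL hb
    have : 0 ≤ ∫ r in L..b, hq L r := by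
      rw [intervalIntegral.integral_of_le hb]
      exact setIntegral_nonneg measurableSet_Ioc fun x hx => hq_nonneg hL hx.1
    nlinarith
  rw [e, Measure.add_apply, Measure.smul_apply, withDensity_apply _ measurableSet_Iic,
    Measure.restrict_restrict measurableSet_Iic, Set.inter_comm, Set.Ioc_inter_Iic,
    Measure.dirac_apply' _ measurableSet_Iic]
  rcases lt_or_ge r 0 with hr | hr
  · have : Set.Ioc L (B ⊓ r) = ∅ := Set.Ioc_eq_empty (by simp; intros; linarith)
    rw [this, h0 r hr]
    simp [hr]
  rcases le_or_gt r L with hr2 | hr2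
  · have : Set.Ioc L (B ⊓ r) = ∅ := Set.Ioc_eq_empty (by simp; intros; linarith)
    rw [this, h1 r hr hr2]
    simp [hr]
  rw [key _ (le_min hLB.le hr2.le)]
  rw [Set.indicator_of_mem (by simpa using hr)]
  simp only [Pi.one_apply, smul_eq_mul, mul_one]
  rw [← ENNReal.ofReal_add ha.le (by linarith [hmono _ (le_min hLB.le hr2.le)])]
  congr 1
  rcases le_or_gt r B with hr3 | hr3
  · rw [min_eq_right hr3, h2 r hr2 hr3]; ring
  · rw [min_eq_left hr3.le, h3 r hr3, haB]; ring

lemma Rev_eq {L B a : ℝ} (hL : 0 < L) (hLB : L < B) (ha : 0 < a)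
    (Qs : ℝ → ℝ) (Qm : Measure ℝ) [IsProbabilityMeasure Qm]
    (hQm : ∀ r, (Qm (Set.Iic r)).toReal = Qs r)
    (hQ : Qm = ENNReal.ofReal a • Measure.dirac 0 +
      (volume.restrict (Set.Ioc L B)).withDensity (fun r => ENNReal.ofReal (a * hq L r)))
    (hae : ∀ᵐ r ∂Qm, r ∈ Set.Ico 0 B)
    (F : ℝ → ℝ) (hF : Monotone F) (hF1 : ∀ v, F v ∈ Set.Icc (0 : ℝ) 1) :
    IntegrableOn (fun r => (a * hq L r) * (r * (1 - F r ^ 2))) (Set.Ioc L B) ∧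
    IntegrableOn (fun t => Qs t * (1 - F t) ^ 2) (Set.Ioc 0 B) ∧
    ∫ r, (r * (1 - F r ^ 2) + ∫ t in r..B, (1 - F t) ^ 2) ∂Qm =
      (∫ r in Set.Ioc L B, (a * hq L r) * (r * (1 - F r ^ 2))) +
      ∫ t in Set.Ioc 0 B, Qs t * (1 - F t) ^ 2 := by
  have hFm : Measurable F := hF.measurable
  have hB : 0 < B := hL.trans hLB
  have hfb : ∀ r, 0 ≤ 1 - F r ^ 2 ∧ 1 - F r ^ 2 ≤ 1 := fun r => by
    have := hF1 r
    constructor <;> nlinarith [this.1, this.2]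
  have hgb : ∀ r, 0 ≤ (1 - F r) ^ 2 ∧ (1 - F r) ^ 2 ≤ 1 := fun r => by
    have := hF1 r
    constructor <;> nlinarith [this.1, this.2]
  have hfm : Measurable (fun r => r * (1 - F r ^ 2)) := by fun_prop
  have hgm : Measurable (fun r => (1 - F r) ^ 2) := by fun_prop
  have hfi : Integrable (fun r => r * (1 - F r ^ 2)) Qm := by
    refine Integrable.of_bound hfm.aestronglyMeasurable B ?_
    filter_upwards [hae] with r hr
    rw [Real.norm_eq_abs, abs_of_nonneg (mul_nonneg hr.1 (hfb r).1)]
    nlinarith [hr.1, hr.2, hfb r]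
  have hqm : Measurable (fun r => ENNReal.ofReal (a * hq L r)) :=
    ((hq_meas L).const_mul a).ennreal_ofReal
  have hfi2 : IntegrableOn (fun r => (a * hq L r) * (r * (1 - F r ^ 2))) (Set.Ioc L B) := by
    have : IntegrableOn (fun r => (r * (1 - F r ^ 2)) * (a * hq L r)) (Set.Ioc L B) := by
      refine Integrable.bdd_mul (c := B) ((hq_int hL hLB.le).1.const_mul a)
        hfm.aestronglyMeasurable ?_
      filter_upwards [ae_restrict_mem measurableSet_Ioc] with r hr
      have h0 : 0 ≤ r := by linarith [hr.1]
      rw [Real.norm_eq_abs, abs_of_nonneg (mul_nonneg h0 (hfb r).1)]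
      nlinarith [hr.1, hr.2, hfb r]
    refine this.congr (Filter.Eventually.of_forall fun r => ?_)
    simp only; ring
  have e1 : ∫ r, r * (1 - F r ^ 2) ∂Qm
      = ∫ r in Set.Ioc L B, (a * hq L r) * (r * (1 - F r ^ 2)) := by
    have hfi' := hfi
    rw [hQ] at hfi'
    rw [hQ, integral_add_measure hfi'.left_of_add_measure hfi'.right_of_add_measure,
      integral_smul_measure, integral_dirac,
      integral_withDensity_eq_integral_toReal_smul hqm
        (Filter.Eventually.of_forall fun _ => ENNReal.ofReal_lt_top)]
    simp only [zero_mul, smul_zero, zero_add]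
    apply setIntegral_congr_fun measurableSet_Ioc
    intro r hr
    simp only [smul_eq_mul]
    rw [ENNReal.toReal_ofReal (mul_nonneg ha.le (hq_nonneg hL hr.1))]
  -- Fubini
  let S : Set (ℝ × ℝ) := {p | p.1 ≤ p.2}
  have hS : MeasurableSet S := measurableSet_le measurable_fst measurable_snd
  let G : ℝ × ℝ → ℝ := S.indicator (fun p => (1 - F p.2) ^ 2)
  have hGm : Measurable G := (hgm.comp measurable_snd).indicator hS
  have hGi : Integrable G (Qm.prod (volume.restrict (Set.Ioc 0 B))) := by
    refine Integrable.of_bound hGm.aestronglyMeasurable 1 (Filter.Eventually.of_forall fun p => ?_)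
    simp only [G, Set.indicator]
    split_ifs
    · rw [Real.norm_eq_abs, abs_of_nonneg (hgb _).1]; exact (hgb _).2
    · simp
  have hin : ∀ t, ∫ r, G (r, t) ∂Qm = Qs t * (1 - F t) ^ 2 := by
    intro t
    have : (fun r => G (r, t)) = (Set.Iic t).indicator (fun _ => (1 - F t) ^ 2) := by
      ext r; simp [G, S, Set.indicator]
    rw [this, integral_indicator_const _ measurableSet_Iic, ← hQm]
    rfl
  have hK : ∀ r ∈ Set.Ico 0 B, ∫ t in r..B, (1 - F t) ^ 2
      = ∫ t in Set.Ioc 0 B, G (r, t) := by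
    intro r hr
    have : (fun t => G (r, t)) = (Set.Ici r).indicator (fun t => (1 - F t) ^ 2) := by
      ext t; simp [G, S, Set.indicator]
    rw [this, integral_indicator measurableSet_Ici, Measure.restrict_restrict measurableSet_Ici,
      intervalIntegral.integral_of_le hr.2.le]
    apply setIntegral_congr_set
    have h : (Set.Ici r ∩ Set.Ioc 0 B : Set ℝ) =ᵐ[volume] (Set.Ioi r ∩ Set.Ioc 0 B : Set ℝ) :=
      (Ioi_ae_eq_Ici.symm).inter (Filter.EventuallyEq.refl _ _)
    refine Filter.EventuallyEq.trans ?_ h.symm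
    have hs : (Set.Ioc r B : Set ℝ) = Set.Ioi r ∩ Set.Ioc 0 B := ?_
    · rw [hs]; exact Filter.EventuallyEq.refl _ _
    ext x
    simp only [Set.mem_Ioc, Set.mem_inter_iff, Set.mem_Ioi]
    constructor
    · rintro ⟨h1, h2⟩; exact ⟨h1, lt_of_le_of_lt hr.1 h1, h2⟩
    · rintro ⟨h1, h2, h3⟩; exact ⟨h1, h3⟩
  refine ⟨hfi2, ?_, ?_⟩
  · have : Integrable (fun t => ∫ r, G (r, t) ∂Qm) (volume.restrict (Set.Ioc 0 B)) :=
      hGi.integral_prod_right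
    simp only [hin] at this
    exact this
  · have : ∫ r, (r * (1 - F r ^ 2) + ∫ t in r..B, (1 - F t) ^ 2) ∂Qm
      = ∫ r, (r * (1 - F r ^ 2) + ∫ t in Set.Ioc 0 B, G (r, t)) ∂Qm := by
      apply integral_congr_ae
      filter_upwards [hae] with r hr
      rw [hK r hr]
    rw [this, integral_add hfi hGi.integral_prod_left, e1]
    congr 1
    rw [integral_integral_swap (f := fun r t => G (r, t)) hGi]
    exact integral_congr_ae (Filter.Eventually.of_forall hin)

lemma Rev_Fs {L B : ℝ} (hL : 0 < L) (hLB : L < B) (Fs : ℝ → ℝ)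
    (hFs : ∀ v, Fs v = if v < L then 0 else if v < B then 1 - L / v else 1)
    (r : ℝ) (hr : r ∈ Set.Ico 0 B) :
    r * (1 - (Fs r) ^ 2) + ∫ t in r..B, (1 - Fs t) ^ 2 = 2 * L - L ^ 2 / B := by
  have hB : 0 < B := hL.trans hLB
  have tail : ∀ s, L ≤ s → s ≤ B → IntervalIntegrable (fun t => (1 - Fs t) ^ 2) volume s B ∧
      ∫ t in s..B, (1 - Fs t) ^ 2 = L ^ 2 / s - L ^ 2 / B := by
    intro s hs hsB
    have hc : ∀ x ∈ Set.Icc s B, HasDerivAt (fun t => - (L ^ 2 * t⁻¹)) (L ^ 2 / x ^ 2) x := by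
      intro x hx
      have hx0 : x ≠ 0 := by linarith [hx.1]
      refine (((hasDerivAt_inv hx0).const_mul (L ^ 2)).neg).congr_deriv ?_
      field_simp
    have hi : IntervalIntegrable (fun t => L ^ 2 / t ^ 2) volume s B := by
      apply ContinuousOn.intervalIntegrable
      rw [Set.uIcc_of_le hsB]
      apply ContinuousOn.div continuousOn_const (by fun_prop)
      intro x hx
      have hx0 : x ≠ 0 := by linarith [hx.1]
      positivity
    have hae : ∀ᵐ t ∂volume, t ∈ Set.uIoc s B → L ^ 2 / t ^ 2 = (1 - Fs t) ^ 2 := by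
      filter_upwards [Measure.ae_ne volume B] with t ht htm
      rw [Set.uIoc_of_le hsB] at htm
      have h2 : t < B := lt_of_le_of_ne htm.2 ht
      rw [hFs, if_neg (by linarith [htm.1]), if_pos h2]
      ring
    constructor
    · exact hi.congr_ae ((ae_restrict_iff' measurableSet_uIoc).2 hae)
    · rw [← intervalIntegral.integral_congr_ae hae,
        intervalIntegral.integral_eq_sub_of_hasDerivAt (by rwa [Set.uIcc_of_le hsB]) hi]
      ring
  rcases le_or_gt L r with h | h
  · rw [(tail r h hr.2.le).2, hFs, if_neg (by linarith), if_pos hr.2]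
    have : r ≠ 0 := by linarith
    field_simp
    ring
  · have h1 : ∀ᵐ t ∂volume, t ∈ Set.uIoc r L → (1:ℝ) = (1 - Fs t) ^ 2 := by
      filter_upwards [Measure.ae_ne volume L] with t ht htm
      rw [Set.uIoc_of_le h.le] at htm
      have h2 : t < L := lt_of_le_of_ne htm.2 ht
      rw [hFs, if_pos h2]; norm_num
    have hi : IntervalIntegrable (fun t => (1 - Fs t) ^ 2) volume r L :=
      (intervalIntegrable_const (c := (1:ℝ))).congr_ae
        ((ae_restrict_iff' measurableSet_uIoc).2 h1)
    obtain ⟨ht1, ht2⟩ := tail L le_rfl hLB.le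
    rw [← intervalIntegral.integral_add_adjacent_intervals hi ht1, ht2,
      ← intervalIntegral.integral_congr_ae h1, hFs, if_pos h]
    simp only [intervalIntegral.integral_const, smul_eq_mul]
    field_simp
    ring


/-- `(Q*, F*)` is a saddle point of the two-bidder reduced zero-sum game: every
compatible value distribution `F` yields revenue at least `Rev_{F*}(Q*)` against `Q*`;
every reserve-price distribution `Q` on `[0, B]` yields revenue at most `Rev_{F*}(Q*)`
against `F*`; and the equilibrium value is `2L - L²/B`. -/
theorem two_bidder_saddle_point (B μ L : ℝ)
    (hB : 0 < B) (hμ0 : 0 < μ) (hμB : μ < B)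
    (hL : L ∈ Set.Ioo (0 : ℝ) B) (hLμ : L * (1 + Real.log (B / L)) = μ)
    (Fs : ℝ → ℝ)
    (hFs : ∀ v, Fs v = if v < L then 0 else if v < B then 1 - L / v else 1)
    (Qs : ℝ → ℝ)
    (hQs : ∀ r, Qs r =
      if r < 0 then 0
      else if r ≤ L then (1 - L / B) / Real.log (B / L)
      else if r ≤ B then (1 - L / B) * (r / (r - L)) * (Real.log (r / L) / Real.log (B / L))
      else 1)
    (Qm : Measure ℝ) [IsProbabilityMeasure Qm]
    (hQm : ∀ r, (Qm (Set.Iic r)).toReal = Qs r)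
    (Rev : (ℝ → ℝ) → ℝ → ℝ)
    (hRev : ∀ F r, Rev F r = r * (1 - (F r) ^ 2) + ∫ t in r..B, (1 - F t) ^ 2) :
    (∀ F : ℝ → ℝ, Monotone F → (∀ x, ContinuousWithinAt F (Set.Ici x) x) →
      (∀ v, F v ∈ Set.Icc (0 : ℝ) 1) → (∀ v, v < 0 → F v = 0) → (∀ v, B ≤ v → F v = 1) →
      (∫ v in (0 : ℝ)..B, (1 - F v)) = μ →
      (∫ r, Rev F r ∂Qm) ≥ ∫ r, Rev Fs r ∂Qm) ∧
    (∀ Q : Measure ℝ, IsProbabilityMeasure Q → Q (Set.Icc 0 B) = 1 →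
      (∫ r, Rev Fs r ∂Q) ≤ ∫ r, Rev Fs r ∂Qm) ∧
    (∫ r, Rev Fs r ∂Qm) = 2 * L - L ^ 2 / B := by
  obtain ⟨hL0, hLB⟩ := hL
  have hlog : 0 < Real.log (B / L) := Real.log_pos ((one_lt_div hL0).2 hLB)
  obtain ⟨a, ha⟩ : ∃ a, a = (1 - L / B) / Real.log (B / L) := ⟨_, rfl⟩
  have hLB1 : 0 < 1 - L / B := by
    have := (div_lt_one hB).2 hLB
    linarith
  have ha0 : 0 < a := ha ▸ div_pos hLB1 hlog
  have hal : a * Real.log (B / L) = 1 - L / B := by rw [ha]; field_simp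
  have haB : a * (B * dslope Real.log L B) = 1 := by
    rw [H_eq hL0 hLB]
    have : B - L ≠ 0 := by linarith
    calc a * (B / (B - L) * Real.log (B / L)) = (a * Real.log (B / L)) * (B / (B - L)) := by ring
      _ = 1 := by rw [hal]; field_simp
  have q0 : ∀ r < 0, Qs r = 0 := fun r hr => by rw [hQs, if_pos hr]
  have q1 : ∀ r, 0 ≤ r → r ≤ L → Qs r = a := fun r h1 h2 => by
    rw [hQs, if_neg (not_lt.2 h1), if_pos h2, ha]
  have q2 : ∀ r, L < r → r ≤ B → Qs r = a * (r * dslope Real.log L r) := fun r h1 h2 => by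
    rw [hQs, if_neg (by linarith), if_neg (by linarith), if_pos h2, H_eq hL0 h1, ha]
    ring
  have q3 : ∀ r, B < r → Qs r = 1 := fun r h1 => by
    rw [hQs, if_neg (by linarith), if_neg (by linarith), if_neg (by linarith)]
  have hQ := Qm_eq hL0 hLB ha0 haB Qs q0 q1 q2 q3 Qm hQm
  have hae : ∀ᵐ r ∂Qm, r ∈ Set.Ico 0 B := by
    rw [hQ, ae_add_measure_iff]
    constructor
    · apply Measure.ae_smul_measure
      exact (ae_dirac_iff (p := fun x => x ∈ Set.Ico 0 B) measurableSet_Ico).2 ⟨le_rfl, hB⟩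
    · apply (withDensity_absolutelyContinuous _ _).ae_le
      filter_upwards [ae_restrict_mem measurableSet_Ioc,
        ae_restrict_of_ae (Measure.ae_ne volume B)] with r hr hne
      exact ⟨by linarith [hr.1], lt_of_le_of_ne hr.2 hne⟩
  have hval : (∫ r, Rev Fs r ∂Qm) = 2 * L - L ^ 2 / B := by
    have : (∫ r, Rev Fs r ∂Qm) = ∫ r, (2 * L - L ^ 2 / B) ∂Qm := by
      apply integral_congr_ae
      filter_upwards [hae] with r hr
      rw [hRev, Rev_Fs hL0 hLB Fs hFs r hr]
    rw [this]; simp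
  have hvpos : 0 ≤ 2 * L - L ^ 2 / B := by
    have : L ^ 2 / B = L * (L / B) := by ring
    rw [this]; nlinarith
  refine ⟨?_, ?_, hval⟩
  · intro F hF _ hF1 _ _ hmean
    rw [hval, ge_iff_le]
    simp only [hRev]
    obtain ⟨i1, i2, e⟩ := Rev_eq hL0 hLB ha0 Qs Qm hQm hQ hae F hF hF1
    rw [e]
    have hGi : ∀ s t, IntervalIntegrable (fun v => 1 - F v) volume s t := fun s t =>
      intervalIntegrable_const.sub hF.intervalIntegrable
    have hGm := hmean
    rw [← intervalIntegral.integral_add_adjacent_intervals (hGi 0 L) (hGi L B),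
      intervalIntegral.integral_of_le hL0.le, intervalIntegral.integral_of_le hLB.le] at hGm
    have g1 := (intervalIntegrable_iff_integrableOn_Ioc_of_le hL0.le).1 (hGi 0 L)
    have g2 := (intervalIntegrable_iff_integrableOn_Ioc_of_le hLB.le).1 (hGi L B)
    have hu : Set.Ioc 0 L ∪ Set.Ioc L B = Set.Ioc 0 B := Set.Ioc_union_Ioc_eq_Ioc hL0.le hLB.le
    have i3 := i2.mono_set (Set.Ioc_subset_Ioc_right hLB.le : Set.Ioc 0 L ⊆ Set.Ioc 0 B)
    have i4 := i2.mono_set (Set.Ioc_subset_Ioc_left hL0.le : Set.Ioc L B ⊆ Set.Ioc 0 B)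
    rw [← hu, setIntegral_union (Set.Ioc_disjoint_Ioc_of_le le_rfl) measurableSet_Ioc i3 i4]
    have b1 : ∫ t in Set.Ioc 0 L, (2 * a * (1 - F t) - a)
        ≤ ∫ t in Set.Ioc 0 L, Qs t * (1 - F t) ^ 2 := by
      refine setIntegral_mono_on ((g1.const_mul (2 * a)).sub (integrable_const a)) i3
        measurableSet_Ioc ?_
      intro t ht
      rw [q1 t ht.1.le ht.2]
      nlinarith [mul_nonneg ha0.le (sq_nonneg (F t))]
    obtain ⟨j1, j2⟩ := A_int hL0 hLB.le
    rw [intervalIntegral.integral_of_le hLB.le] at j2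
    have b2 : ∫ t in Set.Ioc L B, (2 * a * (1 - F t) -
          a * L ^ 2 * ((t * dslope Real.log L t - t * hq L t) / t ^ 2))
        ≤ ∫ t in Set.Ioc L B, ((a * hq L t) * (t * (1 - F t ^ 2)) + Qs t * (1 - F t) ^ 2) := by
      refine setIntegral_mono_on ((g2.const_mul (2 * a)).sub (j1.const_mul (a * L ^ 2)))
        (i1.add i4) measurableSet_Ioc ?_
      intro t ht
      rw [q2 t ht.1 ht.2]
      have f := foc hL0 ht.1
      have hA := A_nonneg hL0 ht.1
      have hdiff := mul_nonneg (mul_nonneg ha0.le hA) (sq_nonneg (1 - F t - L / t))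
      set A := t * dslope Real.log L t - t * hq L t with hAd
      have h1 : t * dslope Real.log L t = A + t * hq L t := by rw [hAd]; ring
      have h2 : t * hq L t = 1 - A * (L / t) := by linarith
      have h3 : a * L ^ 2 * (A / t ^ 2) = a * A * (L / t) ^ 2 := by
        rw [div_pow]; ring
      have h4 : a * hq L t * (t * (1 - F t ^ 2)) = a * (t * hq L t) * (1 - F t ^ 2) := by ring
      rw [h4, h3, h1, h2]
      nlinarith
    rw [integral_add i1 i4, integral_sub (g2.const_mul (2 * a)) (j1.const_mul (a * L ^ 2)),
      integral_const_mul, integral_const_mul, j2] at b2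
    rw [integral_sub (g1.const_mul (2 * a)) (integrable_const a), integral_const_mul] at b1
    simp only [integral_const, MeasurableSet.univ, measureReal_restrict_apply, Set.univ_inter,
      Real.volume_real_Ioc_of_le hL0.le, sub_zero, smul_eq_mul] at b1
    have hD : a * L ^ 2 * (1 / L - dslope Real.log L B) = a * L - L ^ 2 / B := by
      have : a * dslope Real.log L B = 1 / B := by
        rw [eq_div_iff hB.ne']; linarith
      calc a * L ^ 2 * (1 / L - dslope Real.log L B)
          = a * (L ^ 2 / L) - L ^ 2 * (a * dslope Real.log L B) := by ring
        _ = a * L - L ^ 2 / B := by rw [this]; field_simp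
    rw [hD] at b2
    have hm : a * μ = a * L + L - L ^ 2 / B := by
      rw [← hLμ]
      calc a * (L * (1 + Real.log (B / L))) = a * L + L * (a * Real.log (B / L)) := by ring
        _ = _ := by rw [hal]; ring
    rw [← hGm] at hm
    linarith
  · intro Q hQp hQ1
    rw [hval]
    have hae' : ∀ᵐ r ∂Q, r ∈ Set.Icc 0 B :=
      (mem_ae_iff_prob_eq_one measurableSet_Icc).2 hQ1
    have hle : ∀ᵐ r ∂Q, Rev Fs r ≤ 2 * L - L ^ 2 / B := by
      filter_upwards [hae'] with r hr
      rcases hr.2.lt_or_eq with h | h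
      · rw [hRev, Rev_Fs hL0 hLB Fs hFs r ⟨hr.1, h⟩]
      · rw [hRev, h, hFs, if_neg (by linarith), if_neg (lt_irrefl _)]
        simpa using hvpos
    by_cases hi : Integrable (Rev Fs) Q
    · calc ∫ r, Rev Fs r ∂Q ≤ ∫ r, (2 * L - L ^ 2 / B) ∂Q :=
            integral_mono_ae hi (integrable_const _) hle
        _ = _ := by simp
    · rw [integral_undef hi]; exact hvpos
end

section
/- The pair (Q*, F*) is a saddle point of the n-bidder reduced zero-sum game: for every compatible CDF F, Rev_F(Q*) ≥ Rev_{F*}(Q*), and for every Borel probability measure Q on [0, B], Rev_{F*}(Q) ≤ Rev_{F*}(Q*). -/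
open MeasureTheory

/-- The `n`-bidder second-price revenue with reserve `r` against the CDF `F`,
truncated at the upper bound `B`. -/
noncomputable def nRev (n : ℕ) (B : ℝ) (F : ℝ → ℝ) (r : ℝ) : ℝ :=
  r * (1 - (F r) ^ n)
    + ∫ t in r..B, (1 - (n : ℝ) * (F t) ^ (n - 1) + ((n : ℝ) - 1) * (F t) ^ n)

lemma polyP (k : ℕ) (s : ℝ) (hs : 0 ≤ s) : 0 ≤ (k:ℝ) * s^(k+1) - (k+1) * s^k + 1 := by
  induction k with
  | zero => simp
  | succ k ih =>
    have h1 : 0 ≤ (s - 1) * (s^(k+1) - 1) := by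
      rcases le_total s 1 with h | h
      · exact mul_nonneg_of_nonpos_of_nonpos (by linarith)
          (by linarith [pow_le_one₀ (n := k+1) hs h])
      · exact mul_nonneg (by linarith) (by linarith [one_le_pow₀ (n := k+1) h])
    have h2 := mul_nonneg hs ih
    push_cast
    have : ((k:ℝ)+1) * s^(k+1+1) - (k+1+1) * s^(k+1) + 1
      = s * ((k:ℝ) * s^(k+1) - (k+1) * s^k + 1) + (s - 1) * (s^(k+1) - 1) := by ring
    rw [this]; linarith

lemma keyG (m : ℕ) (hm : 1 ≤ m) (x y l w : ℝ) (hx : 0 ≤ x) (hy : 0 < y) (hl : m * y ≤ l)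
    (hw : w * y = y - m * l * (1 - y)) :
    l * (1 - (m+1) * y^m + m * y^(m+1)) + w * (1 - y^(m+1)) + (m+1) * y^m * y ≤
    l * (1 - (m+1) * x^m + m * x^(m+1)) + w * (1 - x^(m+1)) + (m+1) * y^m * x := by
  obtain ⟨k, rfl⟩ : ∃ k, m = k + 1 := ⟨m - 1, by omega⟩
  obtain ⟨s, hs, rfl⟩ : ∃ s, 0 ≤ s ∧ x = s * y := ⟨x / y, by positivity, by field_simp⟩
  have hP := polyP (k+1) s hs
  have hP' := mul_nonneg hs (polyP k s hs)
  push_cast at *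
  have h1 : 0 ≤ (l - (k+1) * y) * (((k:ℝ)+1) * s^(k+1+1) - (k+1+1) * s^(k+1) + 1) :=
    mul_nonneg (by linarith) hP
  have h2 : 0 ≤ y * (k+1+1) * (s * ((k:ℝ) * s^(k+1) - (k+1) * s^k + 1)) := by positivity
  have h3 : 0 ≤ y^(k+1) * ((l - (k+1) * y) * (((k:ℝ)+1) * s^(k+1+1) - (k+1+1) * s^(k+1) + 1)
    + y * (k+1+1) * (s * ((k:ℝ) * s^(k+1) - (k+1) * s^k + 1))) := by positivity
  have h4 : w * y * (y^(k+1) * (s^(k+2)-1)) = (y - (k+1) * l * (1 - y)) * (y^(k+1) * (s^(k+2)-1)) := by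
    rw [hw]
  simp only [mul_pow]
  ring_nf at h3 h4 ⊢
  linarith

lemma qm_eq (L B Q0 : ℝ) (hL : 0 < L) (hLB : L ≤ B) (hQ0 : 0 ≤ Q0) (Qs QL q : ℝ → ℝ)
    (h0 : ∀ r, r < 0 → Qs r = 0) (h1 : ∀ r, 0 ≤ r → r < L → Qs r = Q0)
    (h2 : ∀ r, L ≤ r → r ≤ B → Qs r = QL r) (h3 : ∀ r, B < r → Qs r = QL B)
    (hQL : QL L = Q0) (hd : ∀ r ∈ Set.Icc L B, HasDerivAt QL (q r) r)
    (hc : ContinuousOn q (Set.Icc L B)) (hq : ∀ r ∈ Set.Icc L B, 0 ≤ q r)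
    (Qm : Measure ℝ) [IsProbabilityMeasure Qm]
    (hQm : ∀ r, (Qm (Set.Iic r)).toReal = Qs r) :
    Qm = ENNReal.ofReal Q0 • Measure.dirac 0 +
      (volume.restrict (Set.Ioc L B)).withDensity (fun t => ENNReal.ofReal (q t)) := by
  apply Measure.ext_of_Iic
  intro r
  have hI : ∀ r', L ≤ r' → r' ≤ B →
      ∫⁻ t in Set.Ioc L r', ENNReal.ofReal (q t) = ENNReal.ofReal (QL r' - QL L) := by
    intro r' hr1 hr2
    have hsub : Set.Icc L r' ⊆ Set.Icc L B := Set.Icc_subset_Icc_right hr2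
    have hint : IntervalIntegrable q volume L r' :=
      ContinuousOn.intervalIntegrable (by rw [Set.uIcc_of_le hr1]; exact hc.mono hsub)
    rw [← ofReal_integral_eq_lintegral_ofReal]
    · rw [← intervalIntegral.integral_of_le hr1]
      congr 1
      apply intervalIntegral.integral_eq_sub_of_hasDerivAt _ hint
      intro x hx
      rw [Set.uIcc_of_le hr1] at hx
      exact hd x (hsub hx)
    · exact (intervalIntegrable_iff_integrableOn_Ioc_of_le hr1).1 hint
    · filter_upwards [ae_restrict_mem measurableSet_Ioc] with x hx
      exact hq x (hsub (Set.Ioc_subset_Icc_self hx))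
  have hl : Qm (Set.Iic r) = ENNReal.ofReal (Qs r) := by
    rw [← hQm r, ENNReal.ofReal_toReal (measure_ne_top _ _)]
  rw [hl, Measure.add_apply, withDensity_apply _ measurableSet_Iic,
    Measure.restrict_restrict measurableSet_Iic]
  have hset : Set.Iic r ∩ Set.Ioc L B = Set.Ioc L (min r B) := by
    ext t; simp only [Set.mem_inter_iff, Set.mem_Iic, Set.mem_Ioc, le_min_iff]; tauto
  rw [hset]
  rw [Measure.smul_apply, Measure.dirac_apply' _ measurableSet_Iic]
  rcases lt_or_ge r 0 with hr | hr
  · rw [h0 r hr, Set.Ioc_eq_empty (by simp; intro; linarith)]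
    simp [hr]
  rcases lt_or_ge r L with hr' | hr'
  · rw [h1 r hr hr', Set.Ioc_eq_empty (by simp; intro; linarith)]
    simp [hr]
  rcases le_or_gt r B with hr'' | hr''
  · rw [h2 r hr' hr'', min_eq_left hr'', hI r hr' hr'']
    have h5 : Q0 ≤ QL r := by
      rw [← hQL]
      apply monotoneOn_of_deriv_nonneg (convex_Icc L B)
        (fun x hx => (hd x hx).continuousAt.continuousWithinAt)
        (fun x hx => (hd x (interior_subset hx)).differentiableAt.differentiableWithinAt)
        (fun x hx => by rw [(hd x (interior_subset hx)).deriv]; exact hq x (interior_subset hx))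
        ⟨le_rfl, hLB⟩ ⟨hr', hr''⟩ hr'
    simp only [Set.indicator, Set.mem_Iic, hr, if_true, Pi.one_apply, smul_eq_mul, mul_one]
    rw [← ENNReal.ofReal_add hQ0 (by rw [hQL]; linarith)]
    congr 1; rw [hQL]; ring
  · rw [h3 r hr'', min_eq_right hr''.le, hI B hLB le_rfl]
    have h5 : Q0 ≤ QL B := by
      rw [← hQL]
      apply monotoneOn_of_deriv_nonneg (convex_Icc L B)
        (fun x hx => (hd x hx).continuousAt.continuousWithinAt)
        (fun x hx => (hd x (interior_subset hx)).differentiableAt.differentiableWithinAt)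
        (fun x hx => by rw [(hd x (interior_subset hx)).deriv]; exact hq x (interior_subset hx))
        ⟨le_rfl, hLB⟩ ⟨hLB, le_rfl⟩ hLB
    simp only [Set.indicator, Set.mem_Iic, hr, if_true, Pi.one_apply, smul_eq_mul, mul_one]
    rw [← ENNReal.ofReal_add hQ0 (by rw [hQL]; linarith)]
    congr 1; rw [hQL]; ring

lemma qm_ae (L B Q0 : ℝ) (q : ℝ → ℝ) (Qm : Measure ℝ)
    (hQ : Qm = ENNReal.ofReal Q0 • Measure.dirac 0 +
      (volume.restrict (Set.Ioc L B)).withDensity (fun t => ENNReal.ofReal (q t))) :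
    ∀ᵐ r ∂Qm, r = 0 ∨ r ∈ Set.Ioo L B := by
  rw [hQ, ae_add_measure_iff]
  constructor
  · apply Measure.ae_smul_measure
    rw [ae_dirac_iff (by measurability)]
    left; rfl
  · apply (withDensity_absolutelyContinuous _ _).ae_le
    have : ∀ᵐ t ∂(volume.restrict (Set.Ioc L B)), t ≠ B :=
      ae_restrict_of_ae (Measure.ae_ne volume B)
    filter_upwards [this, ae_restrict_mem measurableSet_Ioc] with t h1 h2
    right; exact ⟨h2.1, lt_of_le_of_ne h2.2 h1⟩

lemma qm_int (L B Q0 : ℝ) (hQ0 : 0 ≤ Q0) (q : ℝ → ℝ) (hqm : ContinuousOn q (Set.Icc L B))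
    (hq : ∀ r ∈ Set.Icc L B, 0 ≤ q r) (Qm : Measure ℝ)
    (hQ : Qm = ENNReal.ofReal Q0 • Measure.dirac 0 +
      (volume.restrict (Set.Ioc L B)).withDensity (fun t => ENNReal.ofReal (q t)))
    (f : ℝ → ℝ) (hf : Integrable f Qm) :
    ∫ r, f r ∂Qm = Q0 * f 0 + ∫ t in Set.Ioc L B, q t * f t := by
  rw [hQ] at hf ⊢
  obtain ⟨h1, h2⟩ := integrable_add_measure.1 hf
  rw [integral_add_measure h1 h2, integral_smul_measure, integral_dirac,
    ENNReal.toReal_ofReal hQ0]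
  congr 1
  have hme : AEMeasurable (fun t => ENNReal.ofReal (q t)) (volume.restrict (Set.Ioc L B)) :=
    ((hqm.mono Set.Ioc_subset_Icc_self).aemeasurable measurableSet_Ioc).ennreal_ofReal
  rw [integral_withDensity_eq_integral_toReal_smul₀ hme (by simp)]
  apply setIntegral_congr_fun measurableSet_Ioc
  intro t ht
  simp only [smul_eq_mul]
  rw [ENNReal.toReal_ofReal (hq t (Set.Ioc_subset_Icc_self ht))]

lemma nRev_succ (m : ℕ) (B : ℝ) (F : ℝ → ℝ) (r : ℝ) :
    nRev (m+1) B F r = r * (1 - F r ^ (m+1)) +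
      ∫ t in r..B, (1 - ((m:ℝ)+1) * F t ^ m + m * F t ^ (m+1)) := by
  simp [nRev]

lemma fub (B C : ℝ) (Qm : Measure ℝ) [IsProbabilityMeasure Qm]
    (hae : ∀ᵐ r ∂Qm, r ∈ Set.Icc 0 B) (g : ℝ → ℝ) (hg : Measurable g) (hC : ∀ t, |g t| ≤ C) :
    Integrable (fun r => ∫ t in r..B, g t) Qm ∧
    ∫ r, (∫ t in r..B, g t) ∂Qm = ∫ t in Set.Icc 0 B, (Qm (Set.Iic t)).toReal * g t := by
  have hC0 : 0 ≤ C := (abs_nonneg _).trans (hC 0)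
  set h : ℝ × ℝ → ℝ := fun p => if p.1 ≤ p.2 then g p.2 else 0 with hh
  have hm : Measurable h :=
    Measurable.ite (measurableSet_le measurable_fst measurable_snd) (hg.comp measurable_snd)
      measurable_const
  have hint : Integrable h (Qm.prod (volume.restrict (Set.Icc 0 B))) := by
    apply Integrable.of_bound hm.aestronglyMeasurable C
    refine Filter.Eventually.of_forall fun p => ?_
    simp only [hh, Real.norm_eq_abs]
    split_ifs
    · exact hC _
    · simpa using hC0
  have e1 : (fun r => ∫ t in r..B, g t) =ᵐ[Qm] fun r => ∫ t in Set.Icc 0 B, h (r, t) := by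
    filter_upwards [hae] with r hr
    rw [intervalIntegral.integral_of_le hr.2, ← integral_Icc_eq_integral_Ioc]
    have : (fun t => h (r, t)) = (Set.Ici r).indicator g := by
      ext t; simp [hh, Set.indicator]
    rw [this, setIntegral_indicator measurableSet_Ici]
    congr 2
    ext t; simp only [Set.mem_inter_iff, Set.mem_Icc, Set.mem_Ici]
    constructor
    · rintro ⟨h1, h2⟩; exact ⟨⟨hr.1.trans h1, h2⟩, h1⟩
    · rintro ⟨⟨_, h2⟩, h1⟩; exact ⟨h1, h2⟩
  refine ⟨(integrable_congr e1).2 hint.integral_prod_left, ?_⟩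
  rw [integral_congr_ae e1]
  rw [integral_integral_swap (f := fun r t => h (r, t)) hint]
  congr 1
  ext t
  have : (fun r => h (r, t)) = (Set.Iic t).indicator (fun _ => g t) := by
    ext r; simp [hh, Set.indicator]
  rw [this, integral_indicator_const _ measurableSet_Iic]
  simp [Measure.real]

lemma reduced (m : ℕ) (L B Q0 : ℝ) (hL : 0 < L) (hLB : L ≤ B) (hQ0 : 0 ≤ Q0)
    (Qs q : ℝ → ℝ) (hqm : ContinuousOn q (Set.Icc L B))
    (hq : ∀ r ∈ Set.Icc L B, 0 ≤ q r) (Qm : Measure ℝ) [IsProbabilityMeasure Qm]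
    (hQm : ∀ r, (Qm (Set.Iic r)).toReal = Qs r)
    (hQ : Qm = ENNReal.ofReal Q0 • Measure.dirac 0 +
      (volume.restrict (Set.Ioc L B)).withDensity (fun t => ENNReal.ofReal (q t)))
    (F : ℝ → ℝ) (hF : Measurable F) (hF1 : ∀ v, F v ∈ Set.Icc (0:ℝ) 1) :
    IntegrableOn (fun t => Qs t * (1 - ((m:ℝ)+1) * F t ^ m + m * F t ^ (m+1))
       + (Set.Ioc L B).indicator (fun t => q t * (t * (1 - F t ^ (m+1)))) t) (Set.Icc 0 B) ∧
    ∫ r, nRev (m+1) B F r ∂Qm = ∫ t in Set.Icc 0 B,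
      (Qs t * (1 - ((m:ℝ)+1) * F t ^ m + m * F t ^ (m+1))
       + (Set.Ioc L B).indicator (fun t => q t * (t * (1 - F t ^ (m+1)))) t) := by
  have hae : ∀ᵐ r ∂Qm, r ∈ Set.Icc 0 B := by
    filter_upwards [qm_ae L B Q0 q Qm hQ] with r hr
    rcases hr with rfl | hr
    · exact ⟨le_rfl, hL.le.trans hLB⟩
    · exact ⟨hL.le.trans hr.1.le, hr.2.le⟩
  have hp : ∀ k v, F v ^ k ∈ Set.Icc (0:ℝ) 1 := fun k v =>
    ⟨pow_nonneg (hF1 v).1 _, pow_le_one₀ (hF1 v).1 (hF1 v).2⟩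
  have hgm : Measurable (fun t => 1 - ((m:ℝ)+1) * F t ^ m + m * F t ^ (m+1)) := by fun_prop
  have hgb : ∀ t, |1 - ((m:ℝ)+1) * F t ^ m + m * F t ^ (m+1)| ≤ 1 + (m+1) + m := by
    intro t
    have h1 := hp m t
    have h2 := hp (m+1) t
    have hm0 : (0:ℝ) ≤ m := by positivity
    rw [abs_le]
    constructor <;> nlinarith [h1.1, h1.2, h2.1, h2.2]
  obtain ⟨i1, e1⟩ := fub B _ Qm hae _ hgm hgb
  have hf : Integrable (fun r => r * (1 - F r ^ (m+1))) Qm := by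
    apply Integrable.of_bound (by fun_prop) B
    filter_upwards [hae] with r hr
    have h2 := hp (m+1) r
    rw [Real.norm_eq_abs, abs_of_nonneg (mul_nonneg hr.1 (by linarith [h2.2]))]
    nlinarith [hr.1, hr.2, h2.1, h2.2]
  have hQsm : Measurable Qs := by
    have : Monotone Qs := by
      intro x y hxy
      rw [← hQm, ← hQm]
      exact ENNReal.toReal_mono (measure_ne_top _ _) (measure_mono (Set.Iic_subset_Iic.2 hxy))
    exact this.measurable
  have hQsb : ∀ t, |Qs t| ≤ 1 := by
    intro t
    rw [← hQm, abs_of_nonneg ENNReal.toReal_nonneg]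
    exact ENNReal.toReal_le_of_le_ofReal zero_le_one (by simpa using prob_le_one)
  have j1 : IntegrableOn (fun t => Qs t * (1 - ((m:ℝ)+1) * F t ^ m + m * F t ^ (m+1)))
      (Set.Icc 0 B) := by
    apply Integrable.of_bound (by fun_prop) (1 * (1 + (m+1) + m))
    refine Filter.Eventually.of_forall fun t => ?_
    rw [Real.norm_eq_abs, abs_mul]
    exact mul_le_mul (hQsb t) (hgb t) (abs_nonneg _) zero_le_one
  have j2' : IntegrableOn (fun t => q t * (t * (1 - F t ^ (m+1)))) (Set.Icc L B) := by
    have hqi : IntegrableOn q (Set.Icc L B) := hqm.integrableOn_compact isCompact_Icc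
    apply Integrable.mul_bdd hqi (c := B) (by fun_prop)
    filter_upwards [ae_restrict_mem measurableSet_Icc] with r hr
    have h2 := hp (m+1) r
    have : 0 ≤ r := hL.le.trans hr.1
    rw [Real.norm_eq_abs, abs_of_nonneg (mul_nonneg this (by linarith [h2.2]))]
    nlinarith [hr.1, hr.2, h2.1, h2.2]
  have j2 : IntegrableOn ((Set.Ioc L B).indicator (fun t => q t * (t * (1 - F t ^ (m+1)))))
      (Set.Icc 0 B) := by
    apply IntegrableOn.integrable_indicator _ measurableSet_Ioc |>.integrableOn
    exact j2'.mono_set Set.Ioc_subset_Icc_self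
  refine ⟨j1.add j2, ?_⟩
  rw [integral_add j1 j2]
  simp only [nRev_succ]
  rw [integral_add hf i1, e1, qm_int L B Q0 hQ0 q hqm hq Qm hQ _ hf,
    setIntegral_indicator measurableSet_Ioc]
  have : Set.Icc 0 B ∩ Set.Ioc L B = Set.Ioc L B := by
    apply Set.inter_eq_right.2
    intro t ht; exact ⟨hL.le.trans ht.1.le, ht.2⟩
  rw [this]
  simp only [hQm]
  ring

lemma QLderiv (m : ℕ) (a L K c t : ℝ) (hm : 1 ≤ m) (hL : 0 < L) (ht : 0 < t) (hta : a < t) :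
    HasDerivAt (fun t => K * (t / (t - a))^m * (c + Real.log (t / L)))
      (K * (t / (t-a))^m * (1 - m * (c + Real.log (t / L)) * (a / (t - a))) / t) t := by
  obtain ⟨k, rfl⟩ : ∃ k, m = k + 1 := ⟨m - 1, by omega⟩
  have h1 : t - a ≠ 0 := by linarith
  have d1 : HasDerivAt (fun t => t / (t - a)) ((1 * (t - a) - t * 1) / (t-a)^2) t :=
    (hasDerivAt_id t).div ((hasDerivAt_id t).sub_const a) h1
  have d2 : HasDerivAt (fun t => c + Real.log (t / L)) ((1 / L) / (t / L)) t :=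
    (((hasDerivAt_id t).div_const L).log (by simp; constructor <;> positivity)).const_add c
  refine HasDerivAt.congr_deriv (((d1.pow (k+1)).const_mul K).mul d2) ?_
  simp only [add_tsub_cancel_right, Pi.pow_apply, pow_succ _ k]
  generalize Real.log (t / L) = l
  generalize (t / (t-a))^k = p
  field_simp
  push_cast
  ring

lemma congrIoo (a b : ℝ) (hab : a ≤ b) (f g : ℝ → ℝ) (h : ∀ t ∈ Set.Ioo a b, f t = g t) :
    ∫ t in a..b, f t = ∫ t in a..b, g t := by
  rw [intervalIntegral.integral_of_le hab, intervalIntegral.integral_of_le hab,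
    integral_Ioc_eq_integral_Ioo, integral_Ioc_eq_integral_Ioo]
  exact setIntegral_congr_fun measurableSet_Ioo h

lemma bddInt (a b C : ℝ) (f : ℝ → ℝ) (hf : Measurable f) (hC : ∀ t, |f t| ≤ C) :
    IntervalIntegrable f volume a b := by
  rw [intervalIntegrable_iff, Set.uIoc]
  apply Integrable.of_bound hf.aestronglyMeasurable C
  exact Filter.Eventually.of_forall hC

lemma FsFacts (m : ℕ) (hm : 2 ≤ m) (B L v₀ a : ℝ) (hL : 0 < L) (hLB : L ≤ B)
    (hv₀ : v₀ = L / m) (ha : a = L / (m:ℝ)^2) (Fs : ℝ → ℝ)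
    (hFs : ∀ v, Fs v = if v < v₀ then 0
      else if v < L then 1 - 1 / (m : ℝ) ^ 2
      else if v < B then 1 - a / v else 1) :
    Measurable Fs ∧ (∀ v, Fs v ∈ Set.Icc (0:ℝ) 1) ∧
    (∫ t in (0:ℝ)..B, (1 - Fs t)) = (m + 1 - 1/m + Real.log (B/L)) * a ∧
    (∀ r ∈ Set.Ico L B, nRev (m+1) B Fs r = B * (1 - (1 - a/B)^(m+1))) ∧
    nRev (m+1) B Fs 0 = B * (1 - (1 - a/B)^(m+1)) ∧
    (∀ r ∈ Set.Icc 0 B, nRev (m+1) B Fs r ≤ B * (1 - (1 - a/B)^(m+1))) ∧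
    (∀ r ∈ Set.Icc 0 B, 0 ≤ nRev (m+1) B Fs r) ∧ 0 ≤ B * (1 - (1 - a/B)^(m+1)) := by
  have hm2 : (2:ℝ) ≤ m := by exact_mod_cast hm
  have hm0 : (0:ℝ) < m := by linarith
  have hv0 : 0 < v₀ := by rw [hv₀]; positivity
  have hvL : v₀ < L := by rw [hv₀, div_lt_iff₀ hm0]; nlinarith
  have ha0 : 0 < a := by rw [ha]; positivity
  have haL : a < L := by rw [ha, div_lt_iff₀ (by positivity)]; nlinarith [mul_pos hL hm0]
  have hB : 0 < B := hL.trans_le hLB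
  have hy : (1 - 1 / (m : ℝ) ^ 2) ∈ Set.Icc (0:ℝ) 1 := by
    have : 1 / (m:ℝ)^2 ≤ 1 := by rw [div_le_one (by positivity)]; nlinarith
    have : 0 ≤ 1 / (m:ℝ)^2 := by positivity
    constructor <;> linarith
  have hyL : 1 - 1 / (m:ℝ)^2 = 1 - a / L := by rw [ha]; field_simp
  have hat : ∀ v, L ≤ v → 1 - a / v ∈ Set.Icc (0:ℝ) 1 := by
    intro v hv
    have h0 : 0 < v := hL.trans_le hv
    have : a / v ≤ 1 := by rw [div_le_one h0]; linarith
    have : 0 ≤ a / v := by positivity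
    constructor <;> linarith
  have hmeas : Measurable Fs := by
    rw [funext hFs]
    refine Measurable.ite measurableSet_Iio measurable_const ?_
    refine Measurable.ite measurableSet_Iio measurable_const ?_
    refine Measurable.ite measurableSet_Iio ?_ measurable_const
    fun_prop
  have hmem : ∀ v, Fs v ∈ Set.Icc (0:ℝ) 1 := by
    intro v
    rw [hFs]
    split_ifs with h1 h2 h3
    · simp
    · exact hy
    · exact hat v (not_lt.1 h2)
    · simp
  have hp : ∀ k v, Fs v ^ k ∈ Set.Icc (0:ℝ) 1 := fun k v =>
    ⟨pow_nonneg (hmem v).1 _, pow_le_one₀ (hmem v).1 (hmem v).2⟩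
  have F1 : ∀ v, v < v₀ → Fs v = 0 := fun v h => by rw [hFs, if_pos h]
  have F2 : ∀ v, v₀ ≤ v → v < L → Fs v = 1 - 1 / (m:ℝ)^2 := fun v h h' => by
    rw [hFs, if_neg (not_lt.2 h), if_pos h']
  have F3 : ∀ v, L ≤ v → v < B → Fs v = 1 - a / v := fun v h h' => by
    rw [hFs, if_neg (not_lt.2 (hvL.le.trans h)), if_neg (not_lt.2 h), if_pos h']
  have F4 : Fs B = 1 := by
    rw [hFs, if_neg (by linarith), if_neg (by linarith), if_neg (lt_irrefl B)]
  set ψ : ℝ → ℝ := fun x => 1 - ((m:ℝ)+1) * x ^ m + m * x ^ (m+1) with hψ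
  have i0 : ∀ u v, IntervalIntegrable (fun t => 1 - Fs t) volume u v := fun u v =>
    bddInt u v 1 _ (by fun_prop) fun t => by
      rw [abs_le]; constructor <;> linarith [(hmem t).1, (hmem t).2]
  have i1 : ∀ u v, IntervalIntegrable (fun t => ψ (Fs t)) volume u v := fun u v =>
    bddInt u v (1 + (m+1) + m) _ (by fun_prop) fun t => by
      have h1 := hp m t
      have h2 := hp (m+1) t
      simp only [hψ]
      rw [abs_le]
      constructor <;> nlinarith [h1.1, h1.2, h2.1, h2.2]
  have hψ0 : ∀ t, 0 ≤ ψ (Fs t) := by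
    intro t
    have := polyP m (Fs t) (hmem t).1
    simp only [hψ]; linarith
  -- integrals of ψ
  have J3 : ∀ r, L ≤ r → r ≤ B → ∫ t in r..B, ψ (Fs t)
      = B * (1 - (1 - a/B)^(m+1)) - r * (1 - (1 - a/r)^(m+1)) := by
    intro r hr hrB
    rw [congrIoo r B hrB _ (fun t => ψ (1 - a / t)) (fun t ht => by
      rw [F3 t (hr.trans ht.1.le) ht.2])]
    have hpos : ∀ t ∈ Set.uIcc r B, 0 < t := by
      intro t ht
      rw [Set.uIcc_of_le hrB] at ht
      exact hL.trans_le (hr.trans ht.1)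
    apply intervalIntegral.integral_eq_sub_of_hasDerivAt
      (f := fun t => t * (1 - (1 - a/t)^(m+1)))
    · intro t ht
      have h0 := hpos t ht
      have d1 : HasDerivAt (fun t => 1 - a / t) (-((0 * t - a * 1) / t^2)) t :=
        ((hasDerivAt_const t a).div (hasDerivAt_id t) h0.ne').const_sub 1
      refine HasDerivAt.congr_deriv ((hasDerivAt_id t).mul ((d1.pow (m+1)).const_sub 1)) ?_
      simp only [hψ, add_tsub_cancel_right, Pi.pow_apply, id]
      rw [pow_succ]
      generalize (1 - a / t)^m = p
      field_simp
      push_cast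
      ring
    · apply ContinuousOn.intervalIntegrable
      have : ContinuousOn (fun t => 1 - a / t) (Set.uIcc r B) :=
        continuousOn_const.sub (continuousOn_const.div continuousOn_id fun t ht => (hpos t ht).ne')
      simp only [hψ]
      fun_prop
  have J2 : ∀ r, v₀ ≤ r → r ≤ L → ∫ t in r..L, ψ (Fs t) = (L - r) * ψ (1 - 1/(m:ℝ)^2) := by
    intro r hr hrL
    rw [congrIoo r L hrL _ (fun t => ψ (1 - 1/(m:ℝ)^2)) (fun t ht => by
      rw [F2 t (hr.trans ht.1.le) ht.2])]
    simp
  have J1 : ∀ r, r ≤ v₀ → ∫ t in r..v₀, ψ (Fs t) = v₀ - r := by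
    intro r hr
    rw [congrIoo r v₀ hr _ (fun t => 1) (fun t ht => by
      rw [F1 t ht.2]; simp [hψ]; right; omega)]
    simp
  have K2 : ∀ r, v₀ ≤ r → r ≤ L → ∫ t in r..B, ψ (Fs t) = (L - r) * ψ (1 - 1/(m:ℝ)^2)
      + (B * (1 - (1 - a/B)^(m+1)) - L * (1 - (1 - a/L)^(m+1))) := by
    intro r hr hrL
    rw [← J2 r hr hrL, ← J3 L le_rfl hLB, intervalIntegral.integral_add_adjacent_intervals (i1 _ _) (i1 _ _)]
  have K1 : ∀ r, r ≤ v₀ → ∫ t in r..B, ψ (Fs t) = B * (1 - (1 - a/B)^(m+1)) - r := by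
    intro r hr
    rw [← intervalIntegral.integral_add_adjacent_intervals (i1 r v₀) (i1 v₀ B), J1 r hr,
      K2 v₀ le_rfl hvL.le, ← hyL]
    have : (L - v₀) * ψ (1 - 1/(m:ℝ)^2) = L * (1 - (1 - 1/(m:ℝ)^2)^(m+1)) - v₀ := by
      have hym : (m:ℝ)^2 * (1 - 1/(m:ℝ)^2) = (m:ℝ)^2 - 1 := by field_simp
      simp only [hψ, hv₀, pow_succ _ m]
      generalize 1 - 1/(m:ℝ)^2 = y at *
      generalize y^m = p
      field_simp
      linear_combination (p) * hym
    linarith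
  have N : ∀ r, nRev (m+1) B Fs r = r * (1 - Fs r ^ (m+1)) + ∫ t in r..B, ψ (Fs t) :=
    fun r => nRev_succ m B Fs r
  have hR0 : 0 ≤ B * (1 - (1 - a/B)^(m+1)) := by
    have := hat B hLB
    have := pow_le_one₀ (n := m+1) this.1 this.2
    exact mul_nonneg hB.le (by linarith)
  have C3 : ∀ r ∈ Set.Ico L B, nRev (m+1) B Fs r = B * (1 - (1 - a/B)^(m+1)) := by
    intro r hr
    rw [N, J3 r hr.1 hr.2.le, F3 r hr.1 hr.2]; ring
  have C1 : ∀ r, r < v₀ → nRev (m+1) B Fs r = B * (1 - (1 - a/B)^(m+1)) := by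
    intro r hr
    rw [N, K1 r hr.le, F1 r hr]; simp
  refine ⟨hmeas, hmem, ?_, C3, C1 0 hv0, ?_, ?_, hR0⟩
  · rw [← intervalIntegral.integral_add_adjacent_intervals (i0 0 v₀) (i0 v₀ B),
      ← intervalIntegral.integral_add_adjacent_intervals (i0 v₀ L) (i0 L B),
      congrIoo 0 v₀ hv0.le _ (fun _ => 1) (fun t ht => by rw [F1 t ht.2]; ring),
      congrIoo v₀ L hvL.le _ (fun _ => 1 / (m:ℝ)^2) (fun t ht => by rw [F2 t ht.1.le ht.2]; ring),
      congrIoo L B hLB _ (fun t => a * t⁻¹) (fun t ht => by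
        rw [F3 t ht.1.le ht.2]; rw [div_eq_mul_inv]; ring),
      intervalIntegral.integral_const_mul, integral_inv_of_pos hL hB]
    simp only [intervalIntegral.integral_const, smul_eq_mul]
    rw [hv₀, ha]
    field_simp
    ring
  · intro r hr
    rcases lt_or_ge r v₀ with h | h
    · exact (C1 r h).le
    rcases lt_or_ge r L with h' | h'
    · rw [N, K2 r h h'.le, F2 r h h', ← hyL]
      have h1 : 0 ≤ (1 - 1 / (m : ℝ) ^ 2)^m := pow_nonneg hy.1 _
      have : 0 ≤ (L - r) * ((m+1) * ((1 - 1 / (m : ℝ) ^ 2)^m * (1 - (1 - 1 / (m : ℝ) ^ 2)))) :=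
        mul_nonneg (by linarith) (mul_nonneg (by linarith) (mul_nonneg h1 (by linarith [hy.2])))
      simp only [hψ, pow_succ _ m]
      nlinarith
    rcases lt_or_ge r B with h'' | h''
    · exact (C3 r ⟨h', h''⟩).le
    · have : r = B := le_antisymm hr.2 h''
      rw [N, this, F4]; simpa using hR0
  · intro r hr
    rw [N]
    apply add_nonneg (mul_nonneg hr.1 (by linarith [(hp (m+1) r).2]))
    exact intervalIntegral.integral_nonneg hr.2 fun t _ => hψ0 t

lemma saddle_aux (m : ℕ) (hm : 2 ≤ m) (B μ L : ℝ)
    (hL : 0 < L) (hLB : L ≤ B)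
    (hLeq : ((m:ℝ) + 1 - 1 / (m : ℝ) + Real.log (B / L)) * L = (m : ℝ) ^ 2 * μ)
    (v₀ a : ℝ) (hv₀ : v₀ = L / (m : ℝ)) (ha : a = L / (m : ℝ) ^ 2)
    (Fs : ℝ → ℝ)
    (hFs : ∀ v, Fs v = if v < v₀ then 0
      else if v < L then 1 - 1 / (m : ℝ) ^ 2
      else if v < B then 1 - a / v else 1)
    (Qs : ℝ → ℝ)
    (hQs : ∀ r, Qs r =
      if r < 0 then 0
      else if r < L then
        (1 - a / B) ^ m * (L / (L - a)) ^ m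
          * (((m : ℝ) - 1 / (m : ℝ)) / ((m : ℝ) - 1 / (m : ℝ) + Real.log (B / L)))
      else if r ≤ B then
        (1 - a / B) ^ m * (r / (r - a)) ^ m
          * (((m : ℝ) - 1 / (m : ℝ) + Real.log (r / L))
            / ((m : ℝ) - 1 / (m : ℝ) + Real.log (B / L)))
      else 1)
    (Qm : Measure ℝ) [IsProbabilityMeasure Qm]
    (hQm : ∀ r, (Qm (Set.Iic r)).toReal = Qs r) :
    (∀ F : ℝ → ℝ, Monotone F → 
      (∀ v, F v ∈ Set.Icc (0 : ℝ) 1) →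
      (∫ v in (0 : ℝ)..B, (1 - F v)) = μ →
      (∫ r, nRev (m+1) B F r ∂Qm) ≥ ∫ r, nRev (m+1) B Fs r ∂Qm) ∧
    (∀ Q : Measure ℝ, IsProbabilityMeasure Q → Q (Set.Icc 0 B) = 1 →
      (∫ r, nRev (m+1) B Fs r ∂Q) ≤ ∫ r, nRev (m+1) B Fs r ∂Qm) := by
  obtain ⟨hmeas, hmem, hmean, C3, C0, Cle, Cnn, hR0⟩ := FsFacts m hm B L v₀ a hL hLB hv₀ ha Fs hFs
  have hm2 : (2:ℝ) ≤ m := by exact_mod_cast hm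
  have hm0 : (0:ℝ) < m := by linarith
  have hv0 : 0 < v₀ := by rw [hv₀]; positivity
  have hvL : v₀ < L := by rw [hv₀, div_lt_iff₀ hm0]; nlinarith
  have ha0 : 0 < a := by rw [ha]; positivity
  have haL : a < L := by rw [ha, div_lt_iff₀ (by positivity)]; nlinarith [mul_pos hL hm0]
  have ham : a * m^2 = L := by rw [ha]; field_simp
  have hB : 0 < B := hL.trans_le hLB
  have hyL : 1 - 1 / (m:ℝ)^2 = 1 - a / L := by rw [ha]; field_simp
  set c : ℝ := (m:ℝ) - 1 / m with hc
  have hcm : c * m = m^2 - 1 := by rw [hc]; field_simp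
  have hc0 : 0 < c := by
    have : 1 / (m:ℝ) ≤ 1 := by rw [div_le_one hm0]; linarith
    rw [hc]; linarith
  set D : ℝ := c + Real.log (B / L) with hD
  have hlogB : 0 ≤ Real.log (B / L) := Real.log_nonneg (by rw [le_div_iff₀ hL]; linarith)
  have hD0 : 0 < D := by linarith
  have hAB : 0 < 1 - a / B := by
    have : a / B < 1 := by rw [div_lt_one hB]; linarith
    linarith
  set K : ℝ := (1 - a / B)^m / D with hK
  have hK0 : 0 < K := by positivity
  set QL : ℝ → ℝ := fun t => K * (t / (t - a))^m * (c + Real.log (t / L)) with hQLdef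
  set q : ℝ → ℝ := fun t =>
    K * (t / (t-a))^m * (1 - m * (c + Real.log (t / L)) * (a / (t - a))) / t with hqdef
  have hw0 : ∀ t, L ≤ t → 0 ≤ 1 - m * (c + Real.log (t / L)) * (a / (t - a)) := by
    intro t ht
    have h0 : 0 < t := by linarith
    have h1 : 0 < t - a := by linarith
    have h2 : Real.log (t / L) ≤ t / L - 1 := Real.log_le_sub_one_of_pos (by positivity)
    have h3 : m * (c + Real.log (t / L)) * (a / (t - a)) ≤ 1 := by
      rw [← mul_div_assoc, div_le_one h1]
      have h4 : m * (c + Real.log (t / L)) * a ≤ m * (c + (t / L - 1)) * a := by gcongr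
      have h5 : m * (c + (t / L - 1)) * a = L - a + (t - L) / m := by
        rw [hc, ha]; field_simp; try ring
      have h6 : (t - L) / m ≤ t - L := div_le_self (by linarith) (by linarith)
      linarith
    linarith
  have hq : ∀ r ∈ Set.Icc L B, 0 ≤ q r := by
    intro t ht
    have h0 : 0 < t := hL.trans_le ht.1
    have h1 : 0 < t - a := by linarith [ht.1]
    have := hw0 t ht.1
    simp only [hqdef]
    positivity
  have hd : ∀ r ∈ Set.Icc L B, HasDerivAt QL (q r) r := by
    intro t ht
    exact QLderiv m a L K c t (by omega) hL (hL.trans_le ht.1) (haL.trans_le ht.1)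
  have hcont : ContinuousOn q (Set.Icc L B) := by
    intro t ht
    have h0 : t ≠ 0 := (hL.trans_le ht.1).ne'
    have h1 : t - a ≠ 0 := by linarith [ht.1]
    have h2 : t / L ≠ 0 := div_ne_zero h0 hL.ne'
    apply ContinuousAt.continuousWithinAt
    simp only [hqdef]
    fun_prop (disch := assumption)
  set Q0 : ℝ := K * (L / (L - a))^m * c with hQ0def
  have hLa : 0 < L - a := by linarith
  have hQ0 : 0 ≤ Q0 := by positivity
  have q1 : ∀ r, 0 ≤ r → r < L → Qs r = Q0 := by
    intro r h h'
    rw [hQs, if_neg (not_lt.2 h), if_pos h', hQ0def, hK]; ring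
  have q2 : ∀ r, L ≤ r → r ≤ B → Qs r = QL r := by
    intro r h h'
    rw [hQs, if_neg (by linarith), if_neg (by linarith), if_pos h', hQLdef, hK]; ring
  have hQLL : QL L = Q0 := by simp [hQLdef, hQ0def, hL.ne']
  have hQ := qm_eq L B Q0 hL hLB hQ0 Qs QL q (fun r h => by rw [hQs, if_pos h]) q1 q2
    (fun r h => by
      rw [hQs, if_neg (by linarith), if_neg (by linarith), if_neg (by linarith)]
      have : 1 - a / B = (B / (B - a))⁻¹ := by
        have : B - a ≠ 0 := by linarith
        field_simp
      have h2 : B / (B - a) ≠ 0 := div_ne_zero hB.ne' (by linarith)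
      simp only [hQLdef, hK]
      rw [← hD, this, inv_pow]
      field_simp) hQLL hd hcont hq Qm hQm
  constructor
  · intro F hF hF1 hFmu
    obtain ⟨iF, eF⟩ := reduced m L B Q0 hL hLB hQ0 Qs q hcont hq Qm hQm hQ F hF.measurable hF1
    obtain ⟨iS, eS⟩ := reduced m L B Q0 hL hLB hQ0 Qs q hcont hq Qm hQm hQ Fs hmeas hmem
    have key : ∀ t, L ≤ t → ∀ x, 0 ≤ x →
        QL t * (1 - ((m:ℝ)+1) * (1 - a/t)^m + m * (1 - a/t)^(m+1))
          + q t * (t * (1 - (1 - a/t)^(m+1))) + (m+1) * K * (1 - a/t)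
        ≤ QL t * (1 - ((m:ℝ)+1) * x^m + m * x^(m+1))
          + q t * (t * (1 - x^(m+1))) + (m+1) * K * x := by
      intro t ht x hx
      have h0 : 0 < t := by linarith
      have h1 : 0 < t - a := by linarith
      have hy : 1 - a / t = (t - a) / t := by field_simp
      have hy0 : 0 < 1 - a / t := by rw [hy]; positivity
      have hl : m * (1 - a/t) ≤ c + Real.log (t / L) := by
        have h2 : 1 - (t/L)⁻¹ ≤ Real.log (t/L) := Real.one_sub_inv_le_log_of_pos (by positivity)
        rw [inv_div] at h2
        have h3 : c - m * (1 - a/t) = - ((1 - L/t) / m) := by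
          rw [hc, ha]; field_simp; ring
        have h4 : 0 ≤ 1 - L / t := by
          have : L / t ≤ 1 := by rw [div_le_one h0]; exact ht
          linarith
        have h6 : (1 - L/t) / m ≤ 1 - L/t := div_le_self h4 (by linarith)
        linarith
      have hw : (1 - m * (c + Real.log (t / L)) * (a / (t - a))) * (1 - a/t)
          = (1 - a/t) - m * (c + Real.log (t / L)) * (1 - (1 - a/t)) := by
        generalize Real.log (t/L) = l
        have : t - a ≠ 0 := h1.ne'
        field_simp
        ring
      have hk := keyG m (by omega) x (1 - a/t) _ _ hx hy0 hl hw
      have hM : 0 ≤ K * (t / (t-a))^m := by positivity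
      have hMK : K * (t / (t-a))^m * (1 - a/t)^m = K := by
        rw [mul_assoc, ← mul_pow, hy]
        have : t / (t - a) * ((t - a) / t) = 1 := by field_simp
        rw [this]; simp
      have hk2 := mul_le_mul_of_nonneg_left hk hM
      have hqt : q t * t = K * (t / (t-a))^m * (1 - m * (c + Real.log (t / L)) * (a / (t - a))) := by
        simp only [hqdef]; field_simp
      have e : ∀ z, QL t * (1 - ((m:ℝ)+1) * z^m + m * z^(m+1))
          + q t * (t * (1 - z^(m+1))) + (m+1) * K * z =
          K * (t / (t-a))^m * ((c + Real.log (t / L)) * (1 - (m+1) * z^m + m * z^(m+1))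
           + (1 - m * (c + Real.log (t / L)) * (a / (t - a))) * (1 - z^(m+1))
           + (m+1) * (1 - a/t)^m * z) := by
        intro z
        simp only [hQLdef]
        rw [← mul_assoc (q t), hqt]
        linear_combination (-(m+1) * z) * hMK
      rw [e, e]; exact hk2
    have hqL : q L = 0 := by
      have : 1 - m * (c + Real.log (L / L)) * (a / (L - a)) = 0 := by
        rw [div_self hL.ne', Real.log_one]
        field_simp
        linear_combination (-a) * hcm - ham
      simp only [hqdef, this]; simp
    have hy0 : c = m * (1 - a / L) := by rw [← hyL, hc]; field_simp
    have G0 : QL L * (1 - ((m:ℝ)+1) * (1 - a/L)^m + m * (1 - a/L)^(m+1)) + (m+1) * K * (1 - a/L)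
        = QL L := by
      have hMK : K * (L / (L-a))^m * (1 - a/L)^m = K := by
        rw [mul_assoc, ← mul_pow]
        have : L / (L - a) * (1 - a / L) = 1 := by field_simp
        rw [this]; simp
      have e1 : (m+1) * K * (1 - a/L) = (m+1) * (K * (L / (L-a))^m * (1 - a/L)^m) * (1 - a/L) := by
        rw [hMK]
      have e2 : (m:ℝ)^2 * (1 - a/L) = m^2 - 1 := by rw [← hyL]; field_simp
      rw [e1, hQLL, hQ0def, hy0, pow_succ]
      linear_combination (K * (L / (L-a))^m * (1 - a/L)^m * (1 - a/L)) * e2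
    have i0 : ∀ G : ℝ → ℝ, Measurable G → (∀ v, G v ∈ Set.Icc (0:ℝ) 1) →
        IntegrableOn (fun t => (m+1) * K * (1 - G t)) (Set.Icc 0 B) := by
      intro G hG hG1
      apply Integrable.const_mul
      apply Integrable.of_bound (by fun_prop) 1
      refine Filter.Eventually.of_forall fun t => ?_
      rw [Real.norm_eq_abs, abs_le]; constructor <;> linarith [(hG1 t).1, (hG1 t).2]
    have im : ∀ G : ℝ → ℝ, (∫ t in (0:ℝ)..B, (1 - G t)) = μ →
        ∫ t in Set.Icc 0 B, (m+1) * K * (1 - G t) = (m+1) * K * μ := by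
      intro G hG
      rw [integral_const_mul, integral_Icc_eq_integral_Ioc,
        ← intervalIntegral.integral_of_le hB.le, hG]
    have hFsmu : (∫ t in (0:ℝ)..B, (1 - Fs t)) = μ := by
      rw [hmean, ha]
      field_simp
      field_simp at hLeq
      linarith
    have final := integral_mono_ae (iS.sub (i0 Fs hmeas hmem)) (iF.sub (i0 F hF.measurable hF1)) (by
      have nL : ∀ᵐ t ∂(volume.restrict (Set.Icc 0 B)), t ≠ L :=
        ae_restrict_of_ae (Measure.ae_ne volume L)
      have nB : ∀ᵐ t ∂(volume.restrict (Set.Icc 0 B)), t ≠ B :=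
        ae_restrict_of_ae (Measure.ae_ne volume B)
      filter_upwards [nL, nB, ae_restrict_mem measurableSet_Icc] with t h1 h2 h3
      simp only [Pi.sub_apply]
      rcases lt_or_ge t L with h | h
      · have hk := key L le_rfl (F t) (hF1 t).1
        rw [hqL] at hk
        rw [Set.indicator_of_notMem (by simp; intro; linarith),
          Set.indicator_of_notMem (by simp; intro; linarith), q1 t h3.1 h, ← hQLL, hFs]
        rcases lt_or_ge t v₀ with h' | h'
        · rw [if_pos h', zero_pow (by omega), zero_pow (by omega)]
          linarith
        · rw [if_neg (not_lt.2 h'), if_pos h, hyL]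
          linarith
      · have hLt : L < t := lt_of_le_of_ne h (Ne.symm h1)
        have htB : t < B := lt_of_le_of_ne h3.2 h2
        have hk := key t h (F t) (hF1 t).1
        have hmt : t ∈ Set.Ioc L B := ⟨hLt, h3.2⟩
        rw [Set.indicator_of_mem hmt, Set.indicator_of_mem hmt, q2 t h h3.2, hFs,
          if_neg (by linarith), if_neg (by linarith), if_pos htB]
        linarith)
    simp only [Pi.sub_apply] at final
    rw [integral_sub iS (i0 Fs hmeas hmem), integral_sub iF (i0 F hF.measurable hF1),
      im F hFmu, im Fs hFsmu, ← eF, ← eS] at final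
    linarith
  · intro Q hQp hQ1
    have e : ∫ r, nRev (m+1) B Fs r ∂Qm = B * (1 - (1 - a/B)^(m+1)) := by
      have : (fun r => nRev (m+1) B Fs r) =ᵐ[Qm] fun _ => B * (1 - (1 - a/B)^(m+1)) := by
        filter_upwards [qm_ae L B Q0 q Qm hQ] with r hr
        rcases hr with rfl | hr
        · exact C0
        · exact C3 r ⟨hr.1.le, hr.2⟩
      rw [integral_congr_ae this]; simp
    rw [e]
    have hae : ∀ᵐ r ∂Q, r ∈ Set.Icc 0 B := (mem_ae_iff_prob_eq_one measurableSet_Icc).2 hQ1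
    have := integral_mono_of_nonneg (μ := Q) (f := fun r => nRev (m+1) B Fs r)
      (g := fun _ => B * (1 - (1 - a/B)^(m+1)))
      (by filter_upwards [hae] with r hr using Cnn r hr) (integrable_const _)
      (by filter_upwards [hae] with r hr using Cle r hr)
    simpa using this

/-- `(Q*, F*)` is a saddle point of the `n`-bidder reduced zero-sum game (`n ≥ 3`):
every compatible value distribution `F` yields expected revenue at least
`Rev_{F*}(Q*)` against `Q*`, and every reserve-price distribution `Q` on `[0, B]`
yields expected revenue at most `Rev_{F*}(Q*)` against `F*`. Here `Q*` is identified
with the probability measure `Qm` on `[0, B]` whose CDF it is. -/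
theorem n_bidder_saddle_point (n : ℕ) (hn : 3 ≤ n) (B μ L : ℝ)
    (hB : 0 < B) (hμ0 : 0 < μ) (hμB : μ < B)
    (hL : L ∈ Set.Ioc (0 : ℝ) B)
    (hLeq : ((n : ℝ) - 1 / ((n : ℝ) - 1) + Real.log (B / L)) * L = ((n : ℝ) - 1) ^ 2 * μ)
    (v₀ a : ℝ) (hv₀ : v₀ = L / ((n : ℝ) - 1)) (ha : a = L / ((n : ℝ) - 1) ^ 2)
    (Fs : ℝ → ℝ)
    (hFs : ∀ v, Fs v = if v < v₀ then 0
      else if v < L then 1 - 1 / ((n : ℝ) - 1) ^ 2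
      else if v < B then 1 - a / v else 1)
    (Qs : ℝ → ℝ)
    (hQs : ∀ r, Qs r =
      if r < 0 then 0
      else if r < L then
        (1 - a / B) ^ (n - 1) * (L / (L - a)) ^ (n - 1)
          * (((n : ℝ) - 1 - 1 / ((n : ℝ) - 1))
            / ((n : ℝ) - 1 - 1 / ((n : ℝ) - 1) + Real.log (B / L)))
      else if r ≤ B then
        (1 - a / B) ^ (n - 1) * (r / (r - a)) ^ (n - 1)
          * (((n : ℝ) - 1 - 1 / ((n : ℝ) - 1) + Real.log (r / L))
            / ((n : ℝ) - 1 - 1 / ((n : ℝ) - 1) + Real.log (B / L)))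
      else 1)
    (Qm : Measure ℝ) [IsProbabilityMeasure Qm]
    (hQm : ∀ r, (Qm (Set.Iic r)).toReal = Qs r) :
    (∀ F : ℝ → ℝ, Monotone F → (∀ x, ContinuousWithinAt F (Set.Ici x) x) →
      (∀ v, F v ∈ Set.Icc (0 : ℝ) 1) → (∀ v, v < 0 → F v = 0) → (∀ v, B ≤ v → F v = 1) →
      (∫ v in (0 : ℝ)..B, (1 - F v)) = μ →
      (∫ r, nRev n B F r ∂Qm) ≥ ∫ r, nRev n B Fs r ∂Qm) ∧
    (∀ Q : Measure ℝ, IsProbabilityMeasure Q → Q (Set.Icc 0 B) = 1 →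
      (∫ r, nRev n B Fs r ∂Q) ≤ ∫ r, nRev n B Fs r ∂Qm) := by
  obtain ⟨m, rfl⟩ : ∃ m, n = m + 1 := ⟨n - 1, by omega⟩
  have hc1 : ((m + 1 : ℕ) : ℝ) = (m:ℝ) + 1 := by push_cast; ring
  simp only [hc1, add_sub_cancel_right, add_tsub_cancel_right] at hLeq hv₀ ha hFs hQs
  obtain ⟨h1, h2⟩ := saddle_aux m (by omega) B μ L hL.1 hL.2 hLeq v₀ a hv₀ ha Fs hFs Qs hQs Qm hQm
  exact ⟨fun F hF _ hF1 _ _ hFm => h1 F hF hF1 hFm, h2⟩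
end
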